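/- arXiv:2203.00397 — 2 statements merged into one kernel-verified Lean document; each statement's English description precedes it below -/
import Mathlib

section
/- Let M = (S, A, R, T, γ) be a finite MDP and φ : S → S_φ a state abstraction with weighting function w. Suppose there is ε ≥ 0 such that whenever φ(s1) = φ(s2), |Q*(s1,a) − Q*(s2,a)| ≤ ε for every action a ∈ A. Let π*_φ be an optimal deterministic policy of the abstract MDP M_φ and let π*_φ∘φ be the induced ground policy s ↦ π*_φ(φ(s)). Then for every state s ∈ S, V*(s) − V^{π*_φ∘φ}(s) ≤ 2ε/(1−γ)². -/
open Finset

theorem sum_mul_le_of_sum_eq_one {ι : Type*} {t : Finset ι} {p f : ι → ℝ} {c : ℝ}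
    (hp : ∀ i ∈ t, 0 ≤ p i) (hp1 : ∑ i ∈ t, p i = 1) (hf : ∀ i ∈ t, f i ≤ c) :
    ∑ i ∈ t, p i * f i ≤ c :=
  calc ∑ i ∈ t, p i * f i ≤ ∑ i ∈ t, p i * c :=
        sum_le_sum fun i hi => mul_le_mul_of_nonneg_left (hf i hi) (hp i hi)
    _ = c := by rw [← sum_mul, hp1, one_mul]

theorem abs_sum_mul_le_of_sum_eq_one {ι : Type*} {t : Finset ι} {p f : ι → ℝ} {c : ℝ}
    (hp : ∀ i ∈ t, 0 ≤ p i) (hp1 : ∑ i ∈ t, p i = 1) (hf : ∀ i ∈ t, |f i| ≤ c) :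
    |∑ i ∈ t, p i * f i| ≤ c := by
  refine (abs_sum_le_sum_abs _ _).trans ?_
  rw [sum_congr rfl fun i hi => by rw [abs_mul, abs_of_nonneg (hp i hi)]]
  exact sum_mul_le_of_sum_eq_one hp hp1 hf

theorem abs_sup'_sub_sup'_le {ι : Type*} {t : Finset ι} (ht : t.Nonempty) {f g : ι → ℝ} {c : ℝ}
    (h : ∀ i ∈ t, |f i - g i| ≤ c) : |t.sup' ht f - t.sup' ht g| ≤ c := by
  rw [abs_sub_le_iff, sub_le_iff_le_add, sub_le_iff_le_add]
  constructor <;> refine sup'_le _ _ fun i hi => ?_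
  · linarith [(abs_sub_le_iff.1 (h i hi)).1, le_sup' g hi]
  · linarith [(abs_sub_le_iff.1 (h i hi)).2, le_sup' f hi]

/-- A function on a finite type satisfying a discounted self-bound is bounded by the fixed point
of that bound. -/
theorem le_div_one_sub_of_forall_le_add_mul {ι : Type*} [Finite ι] {f : ι → ℝ} {c γ : ℝ}
    (hγ : γ < 1) (h : ∀ M, (∀ i, f i ≤ M) → ∀ i, f i ≤ c + γ * M) (i : ι) :
    f i ≤ c / (1 - γ) := by
  have : Nonempty ι := ⟨i⟩
  obtain ⟨j, hj⟩ := Finite.exists_max f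
  refine (hj i).trans ?_
  rw [le_div_iff₀ (sub_pos.2 hγ)]
  linarith [h _ hj j]

/-- (Lemma 3.1 of the dissertation.)  For a `φ_{Q*_ε}`-type approximate
state abstraction, the optimal abstract policy, applied in the ground MDP, is
`2ε/(1-γ)²`-optimal. -/
theorem stmt_2
    {S Sφ A : Type} [Fintype S] [Fintype Sφ] [Fintype A]
    [Nonempty S] [Nonempty Sφ] [Nonempty A] [DecidableEq Sφ]
    -- the ground MDP
    (R : S → A → ℝ) (T : S → A → S → ℝ) (γ RMax : ℝ)
    (hRMax : 0 < RMax)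
    (hR : ∀ s a, 0 ≤ R s a ∧ R s a ≤ RMax)
    (hT0 : ∀ s a s', 0 ≤ T s a s')
    (hT1 : ∀ s a, ∑ s', T s a s' = 1)
    (hγ0 : 0 ≤ γ) (hγ1 : γ < 1)
    -- optimal value functions of the ground MDP (the unique Bellman fixed point)
    (Qstar : S → A → ℝ) (Vstar : S → ℝ)
    (hVstar : ∀ s, Vstar s = univ.sup' univ_nonempty (fun a => Qstar s a))
    (hQstar : ∀ s a, Qstar s a = R s a + γ * ∑ s', T s a s' * Vstar s')
    -- the state abstraction and its weighting function
    (φ : S → Sφ) (hφ : Function.Surjective φ)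
    (w : S → ℝ) (hw : ∀ s, 0 ≤ w s ∧ w s ≤ 1)
    (hwsum : ∀ x : Sφ, ∑ s ∈ univ.filter (fun s => φ s = x), w s = 1)
    -- the induced abstract MDP
    (Rφ : Sφ → A → ℝ) (Tφ : Sφ → A → Sφ → ℝ)
    (hRφ : ∀ x a, Rφ x a = ∑ s ∈ univ.filter (fun s => φ s = x), w s * R s a)
    (hTφ : ∀ x a y, Tφ x a y =
      ∑ s ∈ univ.filter (fun s => φ s = x), w s *
        ∑ s' ∈ univ.filter (fun s' => φ s' = y), T s a s')
    -- optimal value functions of the abstract MDP (the unique Bellman fixed point)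
    (Qφ : Sφ → A → ℝ) (Vφ : Sφ → ℝ)
    (hVφ : ∀ x, Vφ x = univ.sup' univ_nonempty (fun a => Qφ x a))
    (hQφ : ∀ x a, Qφ x a = Rφ x a + γ * ∑ y, Tφ x a y * Vφ y)
    -- ε-similarity of optimal Q-values of co-aggregated states
    (ε : ℝ) (hε : 0 ≤ ε)
    (hsim : ∀ s₁ s₂, φ s₁ = φ s₂ → ∀ a, |Qstar s₁ a - Qstar s₂ a| ≤ ε)
    -- an optimal deterministic policy of the abstract MDP
    (πφ : Sφ → A) (hπφ : ∀ x, Qφ x (πφ x) = Vφ x)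
    -- the ground value function of the induced ground policy `πφ ∘ φ`
    (Vπ : S → ℝ)
    (hVπ : ∀ s, Vπ s = R s (πφ (φ s)) + γ * ∑ s', T s (πφ (φ s)) s' * Vπ s') :
    ∀ s, Vstar s - Vπ s ≤ 2 * ε / (1 - γ) ^ 2 := by
  have hQφ_avg (x : Sφ) (a : A) : Qφ x a =
      ∑ s ∈ univ.filter (fun s => φ s = x), w s * (R s a + γ * ∑ s', T s a s' * Vφ (φ s')) := by
    have hfib (s : S) : ∑ s', T s a s' * Vφ (φ s') =
        ∑ y, (∑ s' ∈ univ.filter (fun s' => φ s' = y), T s a s') * Vφ y := by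
      rw [← sum_fiberwise univ φ]
      refine sum_congr rfl fun y _ => ?_
      rw [sum_mul]
      exact sum_congr rfl fun s' hs' => by rw [(mem_filter.1 hs').2]
    simp only [hQφ, hRφ, hTφ, hfib, mul_add, sum_add_distrib]
    congr 1
    simp only [sum_mul, mul_sum]
    rw [sum_comm]
    refine sum_congr rfl fun s _ => sum_congr rfl fun y _ => sum_congr rfl fun s' _ => ?_
    ring
  have hQ_of_V (M : ℝ) (hM : ∀ s, |Vφ (φ s) - Vstar s| ≤ M) (s : S) (a : A) :
      |Qφ (φ s) a - Qstar s a| ≤ ε + γ * M := by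
    have hw0 : ∀ s' ∈ univ.filter (fun s' => φ s' = φ s), 0 ≤ w s' := fun s' _ => (hw s').1
    have hsub : Qφ (φ s) a - Qstar s a = ∑ s' ∈ univ.filter (fun s' => φ s' = φ s),
        w s' * ((R s' a + γ * ∑ u, T s' a u * Vφ (φ u)) - Qstar s a) := by
      simp only [mul_sub, sum_sub_distrib, ← sum_mul, hwsum, one_mul, ← hQφ_avg]
    rw [hsub]
    refine abs_sum_mul_le_of_sum_eq_one hw0 (hwsum _) fun s' hs' => ?_
    have hsplit : (R s' a + γ * ∑ u, T s' a u * Vφ (φ u)) - Qstar s a =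
        (Qstar s' a - Qstar s a) + γ * ∑ u, T s' a u * (Vφ (φ u) - Vstar u) := by
      rw [hQstar s' a]
      simp only [mul_sub, sum_sub_distrib]
      ring
    rw [hsplit]
    refine (abs_add_le _ _).trans (add_le_add (hsim _ _ (mem_filter.1 hs').2 a) ?_)
    rw [abs_mul, abs_of_nonneg hγ0]
    exact mul_le_mul_of_nonneg_left
      (abs_sum_mul_le_of_sum_eq_one (fun u _ => hT0 _ _ u) (hT1 _ _) fun u _ => hM u) hγ0
  have hV (s : S) : |Vφ (φ s) - Vstar s| ≤ ε / (1 - γ) := by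
    refine le_div_one_sub_of_forall_le_add_mul (f := fun s => |Vφ (φ s) - Vstar s|) hγ1
      (fun M hM s => ?_) s
    simp only [hVφ (φ s), hVstar s]
    exact abs_sup'_sub_sup'_le _ fun a _ => hQ_of_V M hM s a
  have hγ : 1 - γ ≠ 0 := (sub_pos.2 hγ1).ne'
  have hQ (s : S) (a : A) : |Qφ (φ s) a - Qstar s a| ≤ ε / (1 - γ) := by
    convert hQ_of_V _ hV s a using 1
    field_simp
    ring
  intro s
  have hbound : 2 * ε / (1 - γ) ^ 2 = 2 * (ε / (1 - γ)) / (1 - γ) := by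
    field_simp
  rw [hbound]
  refine le_div_one_sub_of_forall_le_add_mul (f := fun s => Vstar s - Vπ s) hγ1
    (fun M hM s => ?_) s
  have hgreedy : Vstar s - Qstar s (πφ (φ s)) ≤ 2 * (ε / (1 - γ)) := by
    have h := hQ s (πφ (φ s))
    rw [hπφ] at h
    linarith [(abs_sub_le_iff.1 h).1, (abs_sub_le_iff.1 (hV s)).2]
  have hsplit : Vstar s - Vπ s = (Vstar s - Qstar s (πφ (φ s))) +
      γ * ∑ s', T s (πφ (φ s)) s' * (Vstar s' - Vπ s') := by
    rw [hVπ s, hQstar s (πφ (φ s))]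
    simp only [mul_sub, sum_sub_distrib]
    ring
  rw [hsplit]
  exact add_le_add hgreedy (mul_le_mul_of_nonneg_left
    (sum_mul_le_of_sum_eq_one (fun u _ => hT0 _ _ u) (hT1 _ _) fun u _ => hM u) hγ0)
end

section
/- Fix finite state and action sets S, A, transition probabilities T, a discount γ ∈ (0,1), and a start state s0. Let π1 and π2 be stochastic stationary policies with sup_{s∈S} Σ_{a∈A} |π1(a|s) − π2(a|s)| ≤ Δ for some Δ ≥ 0. Then the discounted state-visitation distributions satisfy Σ_{s∈S} |ρ_{π1,s0}(s) − ρ_{π2,s0}(s)| ≤ Δ·γ/(1−γ). -/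
open Finset

/-- The `t`-step state distribution of a stochastic stationary policy `π` started at `s0`:
`ρ⁰ = δ_{s0}` and `ρ^{t+1}(s') = Σ_s ρ^t(s) Σ_a π(a|s) T(s'|s,a)`. -/
noncomputable def stepDist {S A : Type} [Fintype S] [Fintype A] [DecidableEq S]
    (T : S → A → S → ℝ) (π : S → A → ℝ) (s0 : S) : ℕ → S → ℝ
  | 0 => fun s => if s = s0 then 1 else 0
  | t + 1 => fun s' => ∑ s, stepDist T π s0 t s * ∑ a, π s a * T s a s'

section StepDist

variable {S A : Type} [Fintype S] [Fintype A] {T : S → A → S → ℝ}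

/-- Pushing a signed weight on state-action pairs through the transition kernel does not increase
its `L¹` norm. -/
theorem sum_abs_transition_le (hT0 : ∀ s a s', 0 ≤ T s a s') (hT1 : ∀ s a, ∑ s', T s a s' = 1)
    (w : S → A → ℝ) :
    ∑ s', |∑ s, ∑ a, w s a * T s a s'| ≤ ∑ s, ∑ a, |w s a| := by
  calc ∑ s', |∑ s, ∑ a, w s a * T s a s'|
      ≤ ∑ s', ∑ s, ∑ a, |w s a| * T s a s' := by
        refine sum_le_sum fun s' _ => (abs_sum_le_sum_abs _ _).trans ?_
        refine sum_le_sum fun s _ => (abs_sum_le_sum_abs _ _).trans (le_of_eq ?_)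
        exact sum_congr rfl fun a _ => by rw [abs_mul, abs_of_nonneg (hT0 s a s')]
    _ = ∑ s, ∑ a, |w s a| := by
        rw [sum_comm]
        refine sum_congr rfl fun s _ => ?_
        rw [sum_comm]
        exact sum_congr rfl fun a _ => by rw [← mul_sum, hT1, mul_one]

variable [DecidableEq S]

theorem stepDist_succ (T : S → A → S → ℝ) (π : S → A → ℝ) (s0 : S) (t : ℕ) (s' : S) :
    stepDist T π s0 (t + 1) s' = ∑ s, ∑ a, stepDist T π s0 t s * π s a * T s a s' := by
  simp only [stepDist, mul_sum, mul_assoc]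

theorem sum_abs_stepDist_le_one (hT0 : ∀ s a s', 0 ≤ T s a s')
    (hT1 : ∀ s a, ∑ s', T s a s' = 1) {π : S → A → ℝ} (hπ0 : ∀ s a, 0 ≤ π s a)
    (hπ1 : ∀ s, ∑ a, π s a = 1) (s0 : S) (t : ℕ) :
    ∑ s, |stepDist T π s0 t s| ≤ 1 := by
  induction t with
  | zero => simp [stepDist, apply_ite abs]
  | succ t ih =>
    simp only [stepDist_succ]
    refine (sum_abs_transition_le hT0 hT1 _).trans (le_trans (le_of_eq ?_) ih)
    refine sum_congr rfl fun s _ => ?_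
    simp only [abs_mul, abs_of_nonneg (hπ0 s _), ← mul_sum, hπ1, mul_one]

theorem sum_abs_stepDist_sub_le (hT0 : ∀ s a s', 0 ≤ T s a s')
    (hT1 : ∀ s a, ∑ s', T s a s' = 1) {π₁ π₂ : S → A → ℝ}
    (hπ₁0 : ∀ s a, 0 ≤ π₁ s a) (hπ₁1 : ∀ s, ∑ a, π₁ s a = 1)
    (hπ₂0 : ∀ s a, 0 ≤ π₂ s a) (hπ₂1 : ∀ s, ∑ a, π₂ s a = 1)
    {Δ : ℝ} (hΔ0 : 0 ≤ Δ) (hΔ : ∀ s, ∑ a, |π₁ s a - π₂ s a| ≤ Δ) (s0 : S) (t : ℕ) :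
    ∑ s, |stepDist T π₁ s0 t s - stepDist T π₂ s0 t s| ≤ t * Δ := by
  induction t with
  | zero => simp [stepDist]
  | succ t ih =>
    simp only [stepDist_succ, ← sum_sub_distrib, ← sub_mul]
    calc _ ≤ ∑ s, ∑ a, |stepDist T π₁ s0 t s * π₁ s a - stepDist T π₂ s0 t s * π₂ s a| :=
          sum_abs_transition_le hT0 hT1 _
      _ ≤ ∑ s, ∑ a, (|stepDist T π₁ s0 t s - stepDist T π₂ s0 t s| * π₁ s a +
            |stepDist T π₂ s0 t s| * |π₁ s a - π₂ s a|) := by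
          refine sum_le_sum fun s _ => sum_le_sum fun a _ => ?_
          rw [← abs_of_nonneg (hπ₁0 s a), ← abs_mul, ← abs_mul, abs_of_nonneg (hπ₁0 s a)]
          exact (abs_add_le _ _).trans' (le_of_eq (by ring_nf))
      _ ≤ ∑ s, (|stepDist T π₁ s0 t s - stepDist T π₂ s0 t s| + |stepDist T π₂ s0 t s| * Δ) := by
          refine sum_le_sum fun s _ => ?_
          rw [sum_add_distrib, ← mul_sum, ← mul_sum, hπ₁1, mul_one]
          gcongr
          exact hΔ s
      _ ≤ t * Δ + 1 * Δ := by
          rw [sum_add_distrib, ← sum_mul]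
          gcongr
          exact sum_abs_stepDist_le_one hT0 hT1 hπ₂0 hπ₂1 s0 t
      _ = _ := by push_cast; ring

theorem summable_discounted_stepDist (hT0 : ∀ s a s', 0 ≤ T s a s')
    (hT1 : ∀ s a, ∑ s', T s a s' = 1) {π : S → A → ℝ} (hπ0 : ∀ s a, 0 ≤ π s a)
    (hπ1 : ∀ s, ∑ a, π s a = 1) {γ : ℝ} (hγ0 : 0 ≤ γ) (hγ1 : γ < 1) (s0 s : S) :
    Summable fun t : ℕ => γ ^ t * stepDist T π s0 t s := by
  refine (summable_geometric_of_lt_one hγ0 hγ1).of_norm_bounded fun t => ?_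
  rw [Real.norm_eq_abs, abs_mul, abs_of_nonneg (pow_nonneg hγ0 t)]
  refine mul_le_of_le_one_right (pow_nonneg hγ0 t) ?_
  exact (single_le_sum (f := fun s => |stepDist T π s0 t s|) (fun _ _ => abs_nonneg _)
    (mem_univ s)).trans (sum_abs_stepDist_le_one hT0 hT1 hπ0 hπ1 s0 t)

end StepDist

/-- (Lemma 5.3 of the dissertation.)  If two stochastic stationary policies
are `Δ`-close in total policy deviation at every state, then their normalized discounted
state-visitation distributions `ρ_{π,s0}(s) = (1-γ) Σ_t γ^t ρ^t_{π,s0}(s)` are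
`Δγ/(1-γ)`-close in `L¹`. -/
theorem stmt_9
    {S A : Type} [Fintype S] [Fintype A] [Nonempty S] [Nonempty A] [DecidableEq S]
    (T : S → A → S → ℝ)
    (hT0 : ∀ s a s', 0 ≤ T s a s') (hT1 : ∀ s a, ∑ s', T s a s' = 1)
    (γ : ℝ) (hγ0 : 0 < γ) (hγ1 : γ < 1)
    (s0 : S)
    (π₁ π₂ : S → A → ℝ)
    (hπ₁0 : ∀ s a, 0 ≤ π₁ s a) (hπ₁1 : ∀ s, ∑ a, π₁ s a = 1)
    (hπ₂0 : ∀ s a, 0 ≤ π₂ s a) (hπ₂1 : ∀ s, ∑ a, π₂ s a = 1)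
    (Δ : ℝ) (hΔ0 : 0 ≤ Δ)
    (hΔ : ∀ s, ∑ a, |π₁ s a - π₂ s a| ≤ Δ) :
    ∑ s, |(1 - γ) * (∑' t : ℕ, γ ^ t * stepDist T π₁ s0 t s) -
          (1 - γ) * (∑' t : ℕ, γ ^ t * stepDist T π₂ s0 t s)| ≤ Δ * γ / (1 - γ) := by
  have hγ : ‖γ‖ < 1 := by rwa [Real.norm_eq_abs, abs_of_pos hγ0]
  have hγ' : 0 < 1 - γ := sub_pos.2 hγ1
  have hsub (s : S) : Summable fun t : ℕ =>
      γ ^ t * (stepDist T π₁ s0 t s - stepDist T π₂ s0 t s) := by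
    simpa only [mul_sub] using
      (summable_discounted_stepDist hT0 hT1 hπ₁0 hπ₁1 hγ0.le hγ1 s0 s).sub
        (summable_discounted_stepDist hT0 hT1 hπ₂0 hπ₂1 hγ0.le hγ1 s0 s)
  have habs (s : S) : Summable fun t : ℕ =>
      γ ^ t * |stepDist T π₁ s0 t s - stepDist T π₂ s0 t s| := by
    simpa only [abs_mul, abs_of_nonneg (pow_nonneg hγ0.le _)] using (hsub s).abs
  calc ∑ s, |(1 - γ) * (∑' t : ℕ, γ ^ t * stepDist T π₁ s0 t s) -
          (1 - γ) * (∑' t : ℕ, γ ^ t * stepDist T π₂ s0 t s)|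
      ≤ ∑ s, (1 - γ) * ∑' t : ℕ, γ ^ t * |stepDist T π₁ s0 t s - stepDist T π₂ s0 t s| := by
        refine sum_le_sum fun s _ => ?_
        rw [← mul_sub, ← (summable_discounted_stepDist hT0 hT1 hπ₁0 hπ₁1 hγ0.le hγ1 s0 s).tsum_sub
          (summable_discounted_stepDist hT0 hT1 hπ₂0 hπ₂1 hγ0.le hγ1 s0 s), abs_mul,
          abs_of_pos hγ']
        simp only [← mul_sub]
        gcongr
        rw [← Real.norm_eq_abs]
        refine tsum_of_norm_bounded (habs s).hasSum fun t => le_of_eq ?_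
        rw [Real.norm_eq_abs, abs_mul, abs_of_nonneg (pow_nonneg hγ0.le t)]
    _ = (1 - γ) * ∑' t : ℕ, γ ^ t * ∑ s, |stepDist T π₁ s0 t s - stepDist T π₂ s0 t s| := by
        rw [← mul_sum, ← Summable.tsum_finsetSum fun s _ => habs s]
        simp only [mul_sum]
    _ ≤ (1 - γ) * (γ / (1 - γ) ^ 2 * Δ) := by
        have hgeom := (hasSum_coe_mul_geometric_of_norm_lt_one hγ).mul_right Δ
        refine mul_le_mul_of_nonneg_left ?_ hγ'.le
        refine hasSum_le (fun t => ?_) (Summable.hasSum ?_) hgeom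
        · calc _ ≤ γ ^ t * (t * Δ) := by
                gcongr
                exact sum_abs_stepDist_sub_le hT0 hT1 hπ₁0 hπ₁1 hπ₂0 hπ₂1 hΔ0 hΔ s0 t
            _ = _ := by ring
        · simpa only [mul_sum] using summable_sum fun s _ => habs s
    _ = Δ * γ / (1 - γ) := by field_simp
end
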